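/- arXiv:2502.19753 — 3 statements merged into one kernel-verified Lean document; each statement's English description precedes it below -/
import Mathlib

section
/- Let n be an odd positive integer, m a positive integer, and x : Fin m → Fin n → ℤ. Then B(x,x) ∈ 2ℤ if and only if 2(n+1) divides wt_E(ρ(x)). -/
open Finset

/-- The bilinear form of `m` copies of the dual `A_n` root lattice,
written in the dual basis. -/
noncomputable def BA (n m : ℕ) (x y : Fin m → Fin n → ℚ) : ℚ :=
  ∑ i, ((∑ j, x i j * y i j) -
    (1 / ((n : ℚ) + 1)) * (∑ j, x i j) * (∑ j, y i j))

/-- The reduction map to `(ℤ/(n+1)ℤ)^m`. -/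
def rhoA (n m : ℕ) (x : Fin m → Fin n → ℤ) : Fin m → ZMod (n + 1) :=
  fun i => ((∑ j, x i j : ℤ) : ZMod (n + 1))

/-- The Euclidean weight of an element of `(ℤ/(n+1)ℤ)^m`. -/
def wtE (n m : ℕ) (u : Fin m → ZMod (n + 1)) : ℕ :=
  ∑ i, (u i).val ^ 2

lemma row_aux (n : ℕ) (hodd : Odd n) (y : Fin n → ℤ) :
    ∃ e : ℤ, ((n : ℤ) + 1) * (∑ j, y j * y j) - (∑ j, y j) * (∑ j, y j) =
      ((n : ℤ) + 1) * (((((∑ j, y j : ℤ) : ZMod (n + 1)).val : ℕ) : ℤ) ^ 2 + 2 * e)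
        - ((((∑ j, y j : ℤ) : ZMod (n + 1)).val : ℕ) : ℤ) ^ 2 := by
  have hv : ((((∑ j, y j : ℤ) : ZMod (n + 1)).val : ℕ) : ℤ) = (∑ j, y j) % ((n : ℤ) + 1) := by
    rw [ZMod.val_intCast]; push_cast; rfl
  rw [hv]
  have hQ : ∃ d : ℤ, ∑ j, y j * y j = ∑ j, y j + 2 * d := by
    have h : ∀ j, ∃ d : ℤ, y j * y j = y j + 2 * d := by
      intro j
      obtain ⟨d, hd⟩ := Int.even_mul_pred_self (y j)
      exact ⟨d, by linarith⟩
    choose d hd using h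
    refine ⟨∑ j, d j, ?_⟩
    rw [Finset.mul_sum, ← Finset.sum_add_distrib]
    exact Finset.sum_congr rfl fun j _ => hd j
  obtain ⟨d, hd⟩ := hQ
  rw [hd]
  generalize (∑ j, y j) = S
  have hS := Int.mul_ediv_add_emod S ((n : ℤ) + 1)
  generalize S / ((n : ℤ) + 1) = q at hS
  generalize S % ((n : ℤ) + 1) = v at hS ⊢
  obtain ⟨p, hp⟩ := hodd
  obtain ⟨t, ht⟩ := Int.even_mul_pred_self v
  have hn : (n : ℤ) = 2 * p + 1 := by exact_mod_cast hp
  rw [hn] at hS ⊢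
  subst hS
  refine ⟨d - t + (p + 1) * q - (p + 1) * q ^ 2 - q * v, ?_⟩
  linear_combination (-(2 * (p : ℤ) + 2)) * ht

theorem stmt1 (n m : ℕ) (hn : 0 < n) (hodd : Odd n) (hm : 0 < m)
    (x : Fin m → Fin n → ℤ) :
    (∃ k : ℤ, ((2 * k : ℤ) : ℚ) =
        BA n m (fun i j => (x i j : ℚ)) (fun i j => (x i j : ℚ))) ↔
      2 * (n + 1) ∣ wtE n m (rhoA n m x) := by
  choose e he using fun i => row_aux n hodd (x i)
  have hN : ((n : ℚ) + 1) ≠ 0 := by positivity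
  have key : ((n : ℚ) + 1) * BA n m (fun i j => (x i j : ℚ)) (fun i j => (x i j : ℚ)) =
      (((n + 1) * ((wtE n m (rhoA n m x) : ℤ) + 2 * ∑ i, e i)
        - (wtE n m (rhoA n m x) : ℤ) : ℤ) : ℚ) := by
    have h1 : ((n : ℤ) + 1) * ((wtE n m (rhoA n m x) : ℤ) + 2 * ∑ i, e i)
        - (wtE n m (rhoA n m x) : ℤ) =
        ∑ i, (((n : ℤ) + 1) * (∑ j, x i j * x i j) - (∑ j, x i j) * (∑ j, x i j)) := by
      simp only [he, wtE, rhoA]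
      push_cast
      rw [Finset.sum_sub_distrib, ← Finset.mul_sum, Finset.sum_add_distrib, ← Finset.mul_sum]
    rw [h1, BA, Finset.mul_sum]
    push_cast
    refine Finset.sum_congr rfl fun i _ => ?_
    field_simp
  generalize wtE n m (rhoA n m x) = W at key ⊢
  generalize (∑ i, e i) = E at key
  generalize BA n m (fun i j => (x i j : ℚ)) (fun i j => (x i j : ℚ)) = b at key ⊢
  obtain ⟨p, hp⟩ := hodd
  rw [← Int.natCast_dvd_natCast]
  push_cast
  have hn' : (n : ℤ) = 2 * p + 1 := by exact_mod_cast hp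
  constructor
  · rintro ⟨k, rfl⟩
    have h : ((n : ℤ) + 1) * (2 * k) = (n + 1) * ((W : ℤ) + 2 * E) - (W : ℤ) := by
      have h2 : ((((n : ℤ) + 1) * (2 * k) : ℤ) : ℚ) =
          (((n + 1) * ((W : ℤ) + 2 * E) - (W : ℤ) : ℤ) : ℚ) := by
        rw [← key]; push_cast; ring
      exact Int.cast_injective h2
    have hW : (W : ℤ) = 2 * ((p + 1) * (W + 2 * E - 2 * k)) := by
      rw [hn'] at h; linarith
    refine ⟨(p + 1) * (W + 2 * E - 2 * k) + E - k, ?_⟩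
    linear_combination h + ((n : ℤ) + 1) * hW
  · rintro ⟨c, hc⟩
    refine ⟨(n + 1) * c + E - c, ?_⟩
    apply mul_left_cancel₀ hN
    rw [key, hc]
    push_cast
    ring
end

section
/- Let n and m be positive integers and C a code of length m over ℤ/(n+1)ℤ. (1) If n is odd and C is Type II, then 8 divides mn. (2) If n is even and C = C^⊥, then 8 divides mn. -/
open Finset

/-- The dual code of a set of codewords. -/
def dualCodeA (n m : ℕ) (C : Set (Fin m → ZMod (n + 1))) :
    Set (Fin m → ZMod (n + 1)) :=
  {u | ∀ v ∈ C, ∑ i, u i * v i = 0}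


lemma gauss_key {q m : ℕ} [NeZero q] (D : AddSubgroup (Fin m → ZMod q))
    (hD : ∀ v, v ∈ D ↔ ∀ c ∈ D, ∑ i, v i * c i = 0)
    (g : ZMod q → ℂ) (ψ : AddChar (ZMod q) ℂ) (hψ : ∀ x, ψ x = 1 → x = 0)
    (hg : ∀ x y, g (x + y) = g x * g y * ψ (x * y))
    (h1 : ∀ v ∈ D, ∏ i, g (v i) = 1) :
    (∑ x, g x) ^ m = (Nat.card D : ℂ) := by
  classical
  have hsum : (∑ x, g x) ^ m = ∑ v : Fin m → ZMod q, ∏ i, g (v i) := by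
    exact Fintype.sum_pow g m
  have hpos : (Fintype.card D : ℂ) ≠ 0 := by
    simp [Fintype.card_ne_zero]
  have hprod : ∀ (v : Fin m → ZMod q) (c : D), ∏ i, g ((v + (c : Fin m → ZMod q)) i)
      = (∏ i, g (v i)) * ψ (∑ i, v i * (c : Fin m → ZMod q) i) := by
    intro v c
    have := h1 c c.2
    simp only [Pi.add_apply, hg, Finset.prod_mul_distrib, this, mul_one]
    congr 1
    have : ∀ (T : Finset (Fin m)) (F : Fin m → ZMod q), ∏ i ∈ T, ψ (F i) = ψ (∑ i ∈ T, F i) := by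
      intro T F
      induction T using Finset.induction_on with
      | empty => simp
      | insert a T ha ih => rw [Finset.prod_insert ha, Finset.sum_insert ha, ih, AddChar.map_add_eq_mul]
    exact this _ _
  have hchar : ∀ v : Fin m → ZMod q, ∑ c : D, ψ (∑ i, v i * (c : Fin m → ZMod q) i)
      = if v ∈ D then (Fintype.card D : ℂ) else 0 := by
    intro v
    split_ifs with hv
    · rw [Finset.sum_congr rfl (g := fun _ => (1 : ℂ))]
      · simp
      · intro c _
        rw [(hD v).1 hv c c.2]; simp
    · rw [hD] at hv
      push Not at hv
      obtain ⟨c, hc, hne⟩ := hv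
      have h2 : ψ (∑ i, v i * c i) ≠ 1 := fun h => hne (hψ _ h)
      have h3 : ∑ d : D, ψ (∑ i, v i * (d : Fin m → ZMod q) i)
          = (∑ d : D, ψ (∑ i, v i * (d : Fin m → ZMod q) i)) * ψ (∑ i, v i * c i) := by
        conv_lhs => rw [← Equiv.sum_comp (Equiv.addRight (⟨c, hc⟩ : D))]
        rw [Finset.sum_mul]
        refine Finset.sum_congr rfl fun d _ => ?_
        rw [← AddChar.map_add_eq_mul, ← Finset.sum_add_distrib]
        simp [mul_add]
      by_contra h0
      apply h2
      have := mul_left_cancel₀ h0 ((mul_one _).trans h3)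
      exact this.symm
  rw [hsum]
  have hdouble : (Fintype.card D : ℂ) * ∑ v : Fin m → ZMod q, ∏ i, g (v i)
      = (Fintype.card D : ℂ) * Fintype.card D := by
    calc (Fintype.card D : ℂ) * ∑ v : Fin m → ZMod q, ∏ i, g (v i)
        = ∑ c : D, ∑ v : Fin m → ZMod q, ∏ i, g ((v + (c : Fin m → ZMod q)) i) := by
          have : ∀ c : D, ∑ v : Fin m → ZMod q, ∏ i, g ((v + (c : Fin m → ZMod q)) i)
              = ∑ v : Fin m → ZMod q, ∏ i, g (v i) := fun c =>
            Equiv.sum_comp (Equiv.addRight (c : Fin m → ZMod q)) (fun v => ∏ i, g (v i))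
          simp only [this]
          simp
      _ = ∑ v : Fin m → ZMod q, (∏ i, g (v i)) * if v ∈ D then (Fintype.card D : ℂ) else 0 := by
          rw [Finset.sum_comm]
          refine Finset.sum_congr rfl fun v _ => ?_
          rw [← hchar, Finset.mul_sum]
          exact Finset.sum_congr rfl fun c _ => hprod v c
      _ = ∑ v : Fin m → ZMod q, if v ∈ D then (Fintype.card D : ℂ) else 0 := by
          refine Finset.sum_congr rfl fun v _ => ?_
          split_ifs with h
          · rw [h1 v h, one_mul]
          · simp
      _ = _ := by
          rw [← Finset.sum_filter]
          simp [Fintype.card_subtype]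
  rw [mul_left_cancel₀ hpos hdouble, Nat.card_eq_fintype_card]

lemma sum_range_dvd (p R : ℕ) (hp : 0 < p) (h : ℕ → ℂ) :
    ∑ y ∈ range (p * R), (if p ∣ y then h y else 0) = ∑ z ∈ range R, h (p * z) := by
  rw [← Finset.sum_filter]
  symm
  refine Finset.sum_nbij (fun z => p * z) ?_ ?_ ?_ ?_
  · intro a ha
    simp at ha ⊢
    exact (Nat.mul_lt_mul_left hp).2 ha
  · intro a _ b _ hab
    exact Nat.eq_of_mul_eq_mul_left hp hab
  · intro y hy
    simp at hy
    obtain ⟨hy, z, rfl⟩ := hy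
    exact ⟨z, by simpa using lt_of_mul_lt_mul_left hy (Nat.zero_le _), rfl⟩
  · simp

lemma sum_range_shift (M : ℕ) (h : ℕ → ℂ) (hper : ∀ y, h (y + M) = h y) (s : ℕ) :
    ∑ y ∈ range M, h (y + s) = ∑ y ∈ range M, h y := by
  induction s with
  | zero => rfl
  | succ s ih =>
    rw [← ih]
    have h1 := Finset.sum_range_succ (fun y => h (y + s)) M
    have h2 := Finset.sum_range_succ' (fun y => h (y + s)) M
    have h3 : h (M + s) = h (0 + s) := by rw [add_comm M s, hper]; simp
    have h4 : ∀ y, h (y + 1 + s) = h (y + (s + 1)) := fun y => by congr 1; ring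
    simp only [h4, ← h3] at h2
    rw [h1] at h2
    exact (add_right_cancel h2).symm

lemma sum_range_mul_per (p R : ℕ) (h : ℕ → ℂ) (hper : ∀ y, h (y + R) = h y) :
    ∑ y ∈ range (p * R), h y = p * ∑ y ∈ range R, h y := by
  induction p with
  | zero => simp
  | succ p ih =>
    rw [add_mul, one_mul, Finset.sum_range_add, ih]
    have : ∀ y, h (p * R + y) = h y := by
      intro y
      clear ih
      induction p with
      | zero => simp
      | succ p ih => rw [← ih, ← hper (p * R + y)]; congr 1; ring
    simp only [this]
    push_cast; ring

lemma gauss_rec (p R s : ℕ) (hp : 0 < p) (h w : ℕ → ℂ)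
    (hper : ∀ y, h (y + p * (p * R)) = h y)
    (hper' : ∀ z, h (p * (z + R)) = h (p * z))
    (hw : ∀ y, h (y + s) = h y * w y) (hws : ∀ y, w (y + s) = w y)
    (hw1 : ∀ y, p ∣ y → w y = 1) (hw2 : ∀ y, ¬ p ∣ y → w y ≠ 1) (hwp : ∀ y, w y ^ p = 1) :
    ∑ y ∈ range (p * (p * R)), h y = p * ∑ z ∈ range R, h (p * z) := by
  have hiter : ∀ t y, h (y + t * s) = h y * w y ^ t ∧ w (y + t * s) = w y := by
    intro t y
    induction t with
    | zero => simp
    | succ t ih =>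
      have : y + (t + 1) * s = (y + t * s) + s := by ring
      rw [this, hw, hws, ih.1, ih.2, pow_succ]
      exact ⟨by ring, rfl⟩
  have hgeo : ∀ y, ∑ t ∈ range p, w y ^ t = if p ∣ y then (p : ℂ) else 0 := by
    intro y
    split_ifs with hy
    · simp [hw1 y hy]
    · rw [geom_sum_eq (hw2 y hy), hwp]; simp
  have hp0 : (p : ℂ) ≠ 0 := by exact_mod_cast hp.ne'
  apply mul_left_cancel₀ hp0
  calc (p : ℂ) * ∑ y ∈ range (p * (p * R)), h y
      = ∑ t ∈ range p, ∑ y ∈ range (p * (p * R)), h (y + t * s) := by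
        simp only [sum_range_shift _ h hper]
        simp
    _ = ∑ y ∈ range (p * (p * R)), if p ∣ y then p * h y else 0 := by
        rw [Finset.sum_comm]
        refine Finset.sum_congr rfl fun y _ => ?_
        simp only [(hiter _ y).1]
        rw [← Finset.mul_sum, hgeo]
        split_ifs <;> ring
    _ = _ := by
        rw [sum_range_dvd p _ hp (fun y => p * h y), ← Finset.mul_sum,
          sum_range_mul_per p R (fun z => h (p * z)) hper']

lemma zmod_sum (q : ℕ) [NeZero q] (h : ℕ → ℂ) : ∑ x : ZMod q, h x.val = ∑ y ∈ range q, h y := by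
  obtain ⟨k, rfl⟩ := Nat.exists_eq_succ_of_ne_zero (NeZero.ne q)
  exact Fin.sum_univ_eq_sum_range h (k + 1)

lemma gauss_step (p R s : ℕ) (hp : 0 < p) (ζ : ℂ) (hζ : IsPrimitiveRoot ζ (p * (p * R)))
    (h1 : p * (p * R) ∣ s * s) (h2 : ∀ y, p * (p * R) ∣ 2 * y * s ↔ p ∣ y) :
    ∑ y ∈ range (p * (p * R)), ζ ^ (y ^ 2) = p * ∑ z ∈ range R, (ζ ^ (p ^ 2)) ^ (z ^ 2) := by
  have hone : ∀ a, p * (p * R) ∣ a → ζ ^ a = 1 := fun a ha => (hζ.pow_eq_one_iff_dvd a).2 ha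
  rw [gauss_rec p R s hp (fun y => ζ ^ (y ^ 2)) (fun y => ζ ^ (2 * y * s))]
  · congr 1
    refine Finset.sum_congr rfl fun z _ => ?_
    rw [← pow_mul, mul_pow]
  · intro y
    have : (y + p * (p * R)) ^ 2 = y ^ 2 + (p * (p * R)) * (2 * y + p * (p * R)) := by ring
    simp only [this]
    rw [pow_add, hone _ (Dvd.intro _ rfl), mul_one]
  · intro z
    have : (p * (z + R)) ^ 2 = (p * z) ^ 2 + (p * (p * R)) * (2 * z + R) := by ring
    simp only [this]
    rw [pow_add, hone _ (Dvd.intro _ rfl), mul_one]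
  · intro y
    have : (y + s) ^ 2 = y ^ 2 + 2 * y * s + s * s := by ring
    simp only [this]
    rw [pow_add, pow_add, hone _ h1, mul_one]
  · intro y
    have : 2 * (y + s) * s = 2 * y * s + s * s * 2 := by ring
    simp only [this]
    rw [pow_add, hone _ (h1.mul_right 2), mul_one]
  · intro y hy
    exact hone _ ((h2 y).2 hy)
  · intro y hy h
    exact hy ((h2 y).1 ((hζ.pow_eq_one_iff_dvd _).1 h))
  · intro y
    rw [← pow_mul]
    apply hone
    have := (h2 (y * p)).2 (Dvd.intro_left y rfl)
    convert this using 1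
    ring

lemma odd_base (p : ℕ) [Fact p.Prime] (hp2 : p ≠ 2) (ζ : ℂ) (hζ : IsPrimitiveRoot ζ p) :
    (∑ y ∈ range p, ζ ^ (y ^ 2)) ^ 2 = ((ZMod.χ₄ p : ℤ) : ℂ) * p := by
  classical
  have : NeZero p := ⟨(Fact.out : p.Prime).ne_zero⟩
  have hF : ringChar (ZMod p) ≠ 2 := by rwa [ZMod.ringChar_zmod_n]
  set ψ : AddChar (ZMod p) ℂ := AddChar.zmodChar p hζ.pow_eq_one with hψdef
  have hψ : ψ.IsPrimitive := AddChar.zmodChar_primitive_of_primitive_root p hζ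
  let χ : MulChar (ZMod p) ℂ := (quadraticChar (ZMod p)).ringHomComp (Int.castRingHom ℂ)
  have hχ1 : χ ≠ 1 := by
    intro h
    obtain ⟨a, ha⟩ := quadraticChar_exists_neg_one hF
    have ha0 : IsUnit a := by
      by_contra h0
      rw [MulChar.map_nonunit _ h0] at ha
      norm_num at ha
    have h3 : χ a = 1 := by rw [h]; exact MulChar.one_apply ha0
    simp only [χ, MulChar.ringHomComp_apply, ha] at h3
    norm_num at h3
  have hχ2 : χ.IsQuadratic := (quadraticChar_isQuadratic (ZMod p)).comp _
  have hmain := gaussSum_sq hχ1 hχ2 hψ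
  have hS : ∑ y ∈ range p, ζ ^ (y ^ 2) = gaussSum χ ψ := by
    rw [← zmod_sum p (fun y => ζ ^ (y ^ 2))]
    have e1 : ∀ x : ZMod p, ζ ^ (x.val ^ 2) = ψ (x ^ 2) := by
      intro x
      have : x ^ 2 = ((x.val ^ 2 : ℕ) : ZMod p) := by simp
      rw [this, hψdef, AddChar.zmodChar_apply']
    simp only [e1]
    rw [← Finset.sum_fiberwise (s := univ) (g := fun x : ZMod p => x ^ 2)]
    have e2 : ∀ z : ZMod p, ∑ x with x ^ 2 = z, ψ (x ^ 2) = (χ z + 1) * ψ z := by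
      intro z
      rw [Finset.sum_congr rfl (g := fun _ => ψ z)]
      · have := quadraticChar_card_sqrts hF z
        rw [Finset.sum_const, nsmul_eq_mul]
        congr 1
        have h5 : (#{x : ZMod p | x ^ 2 = z} : ℤ) = quadraticChar (ZMod p) z + 1 := by
          rw [← this]; congr 2; ext x; simp
        have h6 : ((#{x : ZMod p | x ^ 2 = z} : ℤ) : ℂ) = ((quadraticChar (ZMod p) z + 1 : ℤ) : ℂ) := by
          rw [h5]
        simpa [χ] using h6
      · intro x hx
        simp at hx
        rw [hx]
    simp only [e2, add_mul, one_mul, Finset.sum_add_distrib, gaussSum]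
    rw [AddChar.sum_eq_zero_of_ne_one, add_zero]
    have := hψ one_ne_zero
    simpa using this
  rw [hS, hmain]
  simp only [ZMod.card, χ, MulChar.ringHomComp_apply]
  rw [quadraticChar_neg_one hF]
  simp

lemma odd_gauss (p : ℕ) [Fact p.Prime] (hp2 : p ≠ 2) (j : ℕ) :
    ∀ ζ : ℂ, IsPrimitiveRoot ζ (p ^ (2 * j + 1)) →
    (∑ y ∈ range (p ^ (2 * j + 1)), ζ ^ (y ^ 2)) ^ 2
      = ((ZMod.χ₄ p : ℤ) : ℂ) * (p : ℂ) ^ (2 * j + 1) := by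
  have hp : p.Prime := Fact.out
  induction j with
  | zero =>
    intro ζ hζ
    simpa using odd_base p hp2 ζ (by simpa using hζ)
  | succ j ih =>
    intro ζ hζ
    have e : p ^ (2 * (j + 1) + 1) = p * (p * p ^ (2 * j + 1)) := by ring
    have hpos : 0 < p ^ (2 * (j + 1) + 1) := pow_pos hp.pos _
    have hζ' : IsPrimitiveRoot (ζ ^ (p ^ 2)) (p ^ (2 * j + 1)) :=
      hζ.pow hpos (by ring)
    rw [e] at hζ
    have hstep := gauss_step p (p ^ (2 * j + 1)) (p * p ^ (2 * j + 1)) hp.pos ζ hζ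
      ⟨p ^ (2 * j + 1), by ring⟩ (by
        intro y
        rw [Nat.mul_dvd_mul_iff_right (mul_pos hp.pos (pow_pos hp.pos _)), hp.dvd_mul]
        constructor
        · rintro (h | h)
          · exact absurd ((Nat.prime_dvd_prime_iff_eq hp Nat.prime_two).1 h) hp2
          · exact h
        · exact Or.inr)
    rw [e, hstep, mul_pow, ih _ hζ']
    ring

lemma even_gauss (k : ℕ) : ∀ ζ : ℂ, IsPrimitiveRoot ζ (2 ^ (k + 2)) →
    ∃ r : ℝ, 0 < r ∧ (∑ y ∈ range (2 ^ (k + 2)), ζ ^ (y ^ 2)) ^ 4 = -(r : ℂ) := by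
  induction k using Nat.strong_induction_on with
  | _ k ih =>
  intro ζ hζ
  rcases k with _ | _ | k
  · have h2 : ζ ^ 2 = -1 := by
      have : IsPrimitiveRoot (ζ ^ 2) 2 := hζ.pow (by norm_num) (by norm_num)
      exact this.eq_neg_one_of_two_right
    refine ⟨64, by norm_num, ?_⟩
    norm_num [Finset.sum_range_succ]
    have h9 : ζ ^ 9 = ζ := by linear_combination (ζ^7 - ζ^5 + ζ^3-ζ) * h2
    have h4 : ζ ^ 4 = 1 := by linear_combination (ζ^2-1) * h2
    rw [h9, h4]
    linear_combination (16 * (ζ^2+4*ζ+5)) * h2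
  · have h2 : ζ ^ 4 = -1 := by
      have : IsPrimitiveRoot (ζ ^ 4) 2 := hζ.pow (by norm_num) (by norm_num)
      exact this.eq_neg_one_of_two_right
    have h8 : ζ ^ 8 = 1 := hζ.pow_eq_one
    refine ⟨256, by norm_num, ?_⟩
    have e : ∑ y ∈ range (2 ^ (0 + 1 + 2)), ζ ^ (y ^ 2) = 4 * ζ := by
      norm_num [Finset.sum_range_succ]
      have h9 : ζ ^ 9 = ζ := by linear_combination ζ * h8
      have h16 : ζ ^ 16 = 1 := by linear_combination (ζ ^ 8 + 1) * h8
      have h25 : ζ ^ 25 = ζ := by linear_combination (ζ ^ 17 + ζ ^ 9 + ζ) * h8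
      have h36 : ζ ^ 36 = -1 := by
        linear_combination (ζ ^ 28 + ζ ^ 20 + ζ ^ 12 + ζ ^ 4) * h8 + h2
      have h49 : ζ ^ 49 = ζ := by
        have : ζ ^ 49 = (ζ ^ 8) ^ 6 * ζ := by ring
        rw [this, h8]; ring
      rw [h9, h16, h25, h36, h49, h2]; ring
    rw [e]
    push_cast
    linear_combination 256 * h2
  · have e : 2 ^ (k + 1 + 1 + 2) = 2 * (2 * 2 ^ (k + 2)) := by ring
    have hζ' : IsPrimitiveRoot (ζ ^ (2 ^ 2)) (2 ^ (k + 2)) :=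
      hζ.pow (by positivity) (by ring)
    rw [e] at hζ
    have hstep := gauss_step 2 (2 ^ (k + 2)) (2 ^ (k + 2)) two_pos ζ hζ
      ⟨2 ^ k, by ring⟩ (by
        intro y
        rw [← mul_assoc, Nat.mul_dvd_mul_iff_right (by positivity),
          Nat.mul_dvd_mul_iff_left two_pos])
    obtain ⟨r, hr, h⟩ := ih k (by omega) _ hζ'
    refine ⟨16 * r, by positivity, ?_⟩
    rw [e, hstep, mul_pow, h]
    push_cast; ring

lemma even_of_neg_pow {r d : ℝ} {m : ℕ} (hr : 0 < r) (hd : 0 < d) (h : (-r) ^ m = d) : Even m := by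
  by_contra hm
  rw [Nat.not_even_iff_odd] at hm
  rw [hm.neg_pow] at h
  have := pow_pos hr m
  linarith

lemma two_case {S : ℂ} {r d : ℝ} {m : ℕ} (hr : 0 < r) (hd : 0 < d) (hS : S ^ 2 = -(r : ℂ))
    (h : S ^ m = d) : 4 ∣ m := by
  have h1 : (-r) ^ m = d ^ 2 := by
    have : (-(r : ℂ)) ^ m = (d : ℂ) ^ 2 := by rw [← hS, ← h]; ring
    exact_mod_cast this
  obtain ⟨j, rfl⟩ := (even_of_neg_pow hr (by positivity) h1).two_dvd
  rw [pow_mul, hS] at h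
  obtain ⟨i, rfl⟩ := (even_of_neg_pow hr hd (by exact_mod_cast h)).two_dvd
  exact ⟨i, by ring⟩

lemma four_case {S : ℂ} {r d : ℝ} {m : ℕ} (hr : 0 < r) (hd : 0 < d) (hS : S ^ 4 = -(r : ℂ))
    (h : S ^ m = d) : 8 ∣ m := by
  have h1 : 4 ∣ m := by
    refine two_case (S := S ^ 2) hr (d := d ^ 2) (by positivity) (by rw [← hS]; ring) ?_
    push_cast; rw [← h]; ring
  obtain ⟨j, rfl⟩ := h1
  rw [pow_mul, hS] at h
  obtain ⟨i, rfl⟩ := (even_of_neg_pow hr hd (by exact_mod_cast h)).two_dvd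
  exact ⟨i, by ring⟩

lemma code_key (n m q Nc : ℕ) [NeZero q] (hN : n + 1 = q * Nc) (hco : Nat.Coprime Nc q)
    (C : Submodule (ZMod (n + 1)) (Fin m → ZMod (n + 1)))
    (hC : (C : Set _) = dualCodeA n m (C : Set _)) :
    ∃ D : AddSubgroup (Fin m → ZMod q),
      (∀ v, v ∈ D ↔ ∀ c ∈ D, ∑ i, v i * c i = 0) ∧
      ∀ v ∈ D, (fun i => ((Nc * (v i).val : ℕ) : ZMod (n + 1))) ∈ C := by
  have hdual : ∀ u, u ∈ C ↔ ∀ v ∈ C, ∑ i, u i * v i = 0 := by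
    intro u
    rw [← SetLike.mem_coe, hC]
    rfl
  have hNpos : 0 < Nc := by
    rcases Nat.eq_zero_or_pos Nc with h | h
    · subst h; omega
    · exact h
  have hqN : q ∣ n + 1 := ⟨Nc, hN⟩
  have hcast : ∀ a : ℕ, ((Nc * (a : ZMod q).val : ℕ) : ZMod (n + 1)) = ((Nc * a : ℕ) : ZMod (n + 1)) := by
    intro a
    rw [ZMod.natCast_eq_natCast_iff, hN, mul_comm q Nc, ZMod.val_natCast]
    exact (Nat.mod_modEq a q).mul_left' Nc
  let φ : ZMod q →+ ZMod (n + 1) := AddMonoidHom.mk'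
    (fun x => ((Nc * x.val : ℕ) : ZMod (n + 1))) (by
      intro x y
      have : x + y = ((x.val + y.val : ℕ) : ZMod q) := by simp
      rw [this, hcast]
      push_cast
      ring)
  have hφ : ∀ x, φ x = ((Nc * x.val : ℕ) : ZMod (n + 1)) := fun _ => rfl
  let π : ZMod (n + 1) →+* ZMod q := ZMod.castHom hqN (ZMod q)
  have hmul : ∀ x y, φ x * y = φ (x * π y) := by
    intro x y
    have hx : x = ((x.val : ℕ) : ZMod q) := by simp
    have hy : y = ((y.val : ℕ) : ZMod (n + 1)) := by simp
    have : x * π y = ((x.val * y.val : ℕ) : ZMod q) := by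
      rw [Nat.cast_mul, ← hx]
      congr 1
    rw [this, hφ, hφ, hcast]
    conv_lhs => rw [hy]
    push_cast; ring
  have hπφ : ∀ x, π (φ x) = Nc * x := by
    intro x
    rw [hφ, map_natCast]
    simp
  have hφπ : ∀ y, φ (π y) = (Nc : ZMod (n + 1)) * y := by
    intro y
    have hy : y = ((y.val : ℕ) : ZMod (n + 1)) := by simp
    have : π y = ((y.val : ℕ) : ZMod q) := by
      conv_lhs => rw [hy]
      exact map_natCast π _
    rw [this, hφ, hcast]
    conv_rhs => rw [hy]
    push_cast; ring
  have hinj : ∀ x, φ x = 0 → x = 0 := by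
    intro x hx
    rw [hφ, ZMod.natCast_eq_zero_iff, hN, mul_comm q Nc, Nat.mul_dvd_mul_iff_left hNpos,
      ← ZMod.natCast_eq_zero_iff] at hx
    simpa using hx
  have hunit : IsUnit (Nc : ZMod q) := (ZMod.isUnit_iff_coprime Nc q).2 hco
  refine ⟨C.toAddSubgroup.comap (φ.compLeft (Fin m)), ?_, fun v hv => hv⟩
  have hmem : ∀ v, v ∈ C.toAddSubgroup.comap (φ.compLeft (Fin m)) ↔ (fun i => φ (v i)) ∈ C :=
    fun v => Iff.rfl
  intro v
  rw [hmem]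
  constructor
  · intro hv c hc
    rw [hmem] at hc
    have := (hdual _).1 hv _ hc
    simp only [hmul, hπφ] at this
    rw [← map_sum] at this
    have h0 := hinj _ this
    have : ∑ i, v i * ((Nc : ZMod q) * c i) = (Nc : ZMod q) * ∑ i, v i * c i := by
      rw [Finset.mul_sum]
      exact Finset.sum_congr rfl fun i _ => by ring
    rw [this] at h0
    exact (hunit.mul_right_eq_zero).1 h0
  · intro h
    rw [hdual]
    intro c hc
    have hc' := h (fun i => π (c i)) (by
      rw [hmem]
      simp only [hφπ]
      exact C.smul_mem (Nc : ZMod (n + 1)) hc)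
    simp only [hmul]
    rw [← map_sum, hc', map_zero]

lemma combine {q m : ℕ} [NeZero q] (D : AddSubgroup (Fin m → ZMod q))
    (hD : ∀ v, v ∈ D ↔ ∀ c ∈ D, ∑ i, v i * c i = 0) (ζ : ℂ)
    (hζ : IsPrimitiveRoot (ζ ^ 2) q) (hq : ζ ^ (q * q) = 1)
    (h1 : ∀ v ∈ D, ζ ^ (∑ i, (v i).val ^ 2) = 1) :
    (∑ y ∈ range q, ζ ^ (y ^ 2)) ^ m = (Nat.card D : ℂ) := by
  have hper : ∀ a : ℕ, ζ ^ ((a : ZMod q).val ^ 2) = ζ ^ (a ^ 2) := by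
    intro a
    rw [ZMod.val_natCast]
    conv_rhs => rw [← Nat.mod_add_div a q]
    have : (a % q + q * (a / q)) ^ 2
      = (a % q) ^ 2 + 2 * q * ((a % q) * (a / q)) + q * q * (a / q) ^ 2 := by ring
    rw [this, pow_add, pow_add, pow_mul ζ (2 * q), pow_mul ζ 2 q, pow_mul ζ (q * q), hq, hζ.pow_eq_one]
    simp
  rw [← zmod_sum q (fun y => ζ ^ (y ^ 2))]
  refine gauss_key D hD (fun x => ζ ^ (x.val ^ 2)) (AddChar.zmodChar q hζ.pow_eq_one) ?_ ?_ ?_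
  · intro x hx
    rw [AddChar.zmodChar_apply, hζ.pow_eq_one_iff_dvd, ← ZMod.natCast_eq_zero_iff] at hx
    simpa using hx
  · intro x y
    have e1 : x + y = ((x.val + y.val : ℕ) : ZMod q) := by simp
    have e2 : x * y = ((x.val * y.val : ℕ) : ZMod q) := by simp
    rw [e1, e2, hper, AddChar.zmodChar_apply']
    ring
  · intro v hv
    rw [Finset.prod_pow_eq_pow_sum]
    exact h1 v hv

lemma card_pos_real {q m : ℕ} [NeZero q] (D : AddSubgroup (Fin m → ZMod q)) :
    (0 : ℝ) < (Nat.card D : ℝ) := by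
  exact_mod_cast Nat.card_pos

lemma odd_part (n m : ℕ) (hn : Even n) (C : Submodule (ZMod (n + 1)) (Fin m → ZMod (n + 1)))
    (hC : (C : Set _) = dualCodeA n m (C : Set _)) (p : ℕ) (hp : p.Prime)
    (hodd : Odd (padicValNat p (n + 1))) :
    (p % 4 = 3 → 4 ∣ m) ∧ Even m := by
  have : Fact p.Prime := ⟨hp⟩
  obtain ⟨j, hj⟩ := hodd
  obtain ⟨Nc, hnd, hN⟩ : ∃ Nc, ¬ p ∣ Nc ∧ n + 1 = p ^ (2 * j + 1) * Nc := by
    refine ⟨(n + 1) / p ^ (n + 1).factorization p, Nat.not_dvd_ordCompl hp (by omega), ?_⟩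
    rw [← hj, ← Nat.factorization_def _ hp]
    exact (Nat.ordProj_mul_ordCompl_eq_self (n + 1) p).symm
  have hp2 : p ≠ 2 := by
    rintro rfl
    obtain ⟨l, hl⟩ := hn
    have : 2 ∣ n + 1 := hN ▸ Dvd.dvd.mul_right (dvd_pow_self 2 (by omega)) Nc
    omega
  set q := p ^ (2 * j + 1) with hq
  have hqpos : 0 < q := pow_pos hp.pos _
  have : NeZero q := ⟨hqpos.ne'⟩
  have hco : Nat.Coprime Nc q :=
    Nat.Coprime.pow_right _ ((Nat.Prime.coprime_iff_not_dvd hp).2 hnd).symm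
  obtain ⟨D, hD, -⟩ := code_key n m q Nc hN hco C hC
  have hζ := Complex.isPrimitiveRoot_exp q hqpos.ne'
  set ζ := Complex.exp (2 * Real.pi * Complex.I / q)
  have h2q : Nat.Coprime 2 q :=
    Nat.Coprime.pow_right _ ((Nat.coprime_primes Nat.prime_two hp).2 hp2.symm)
  have hcomb := combine D hD ζ (hζ.pow_of_coprime 2 h2q)
    (by rw [pow_mul, hζ.pow_eq_one, one_pow]) (by
      intro v hv
      rw [hζ.pow_eq_one_iff_dvd, ← ZMod.natCast_eq_zero_iff]
      have := (hD v).1 hv v hv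
      push_cast
      simpa [sq] using this)
  have hsq := odd_gauss p hp2 j ζ hζ
  rw [← hq] at hsq
  set S := ∑ y ∈ range q, ζ ^ (y ^ 2)
  have hdpos := card_pos_real D
  have hp4 : p % 4 = 1 ∨ p % 4 = 3 := by
    have := hp.eq_two_or_odd
    omega
  have h3 : p % 4 = 3 → 4 ∣ m := by
    intro h
    rw [ZMod.χ₄_nat_three_mod_four h] at hsq
    refine two_case (S := S) (r := (p : ℝ) ^ (2 * j + 1)) (d := (Nat.card D : ℝ)) ?_ hdpos ?_ ?_
    · have : (0 : ℝ) < p := by exact_mod_cast hp.pos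
      positivity
    · rw [hsq]; push_cast; ring
    · rw [hcomb]; push_cast; rfl
  refine ⟨h3, ?_⟩
  rcases hp4 with h | h
  · rw [ZMod.χ₄_nat_one_mod_four h] at hsq
    have h5 : (p ^ (2 * j + 1)) ^ m = (Nat.card D) ^ 2 := by
      have : ((p : ℂ) ^ (2 * j + 1)) ^ m = (Nat.card D : ℂ) ^ 2 := by
        rw [← hcomb, ← pow_mul S, mul_comm m 2, pow_mul S, hsq]; simp
      exact_mod_cast this
    have h6 := congrArg (fun x => x.factorization p) h5
    simp [Nat.factorization_pow, hp.factorization_self] at h6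
    by_contra hm
    rw [Nat.not_even_iff_odd] at hm
    have h7 : Odd (m * (2 * j + 1)) := hm.mul ⟨j, rfl⟩
    rw [h6] at h7
    exact (Nat.not_odd_iff_even.2 (even_two_mul _)) h7
  · exact even_iff_two_dvd.2 (dvd_trans (by norm_num) (h3 h))

lemma even_part (n m : ℕ) (hn : Odd n) (C : Submodule (ZMod (n + 1)) (Fin m → ZMod (n + 1)))
    (hC : (C : Set _) = dualCodeA n m (C : Set _))
    (hw : ∀ u ∈ C, 2 * (n + 1) ∣ wtE n m u) : 8 ∣ m := by
  obtain ⟨k, Nc, hnd, hN⟩ := Nat.exists_eq_two_pow_mul_odd (n := n + 1) (by omega)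
  obtain ⟨k, rfl⟩ : ∃ l, k = l + 1 := by
    rcases k with _ | k
    · rw [pow_zero, one_mul] at hN
      rw [← hN] at hnd
      obtain ⟨a, ha⟩ := hn
      obtain ⟨b, hb⟩ := hnd
      omega
    · exact ⟨k, rfl⟩
  set q := 2 ^ (k + 1) with hq
  have hqpos : 0 < q := by positivity
  have : NeZero q := ⟨hqpos.ne'⟩
  have hco2 : Nat.Coprime Nc 2 := hnd.coprime_two_right
  have hco : Nat.Coprime Nc q := Nat.Coprime.pow_right _ hco2
  obtain ⟨D, hD, hDC⟩ := code_key n m q Nc hN hco C hC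
  have h2q : 2 * q = 2 ^ (k + 2) := by rw [hq]; ring
  have hζ := Complex.isPrimitiveRoot_exp (2 * q) (by positivity)
  set ζ := Complex.exp (2 * Real.pi * Complex.I / (2 * q : ℕ))
  have hper : ζ ^ (q * q) = 1 := by
    rw [hζ.pow_eq_one_iff_dvd]
    exact ⟨2 ^ k, by rw [hq]; ring⟩
  have hcomb := combine D hD ζ (hζ.pow (by positivity) rfl) hper (by
      intro v hv
      rw [hζ.pow_eq_one_iff_dvd]
      have h1 := hw _ (hDC v hv)
      have h2 : wtE n m (fun i => ((Nc * (v i).val : ℕ) : ZMod (n + 1)))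
          = Nc * (Nc * ∑ i, (v i).val ^ 2) := by
        simp only [wtE]
        rw [← mul_assoc, Finset.mul_sum]
        refine Finset.sum_congr rfl fun i _ => ?_
        rw [ZMod.val_natCast, Nat.mod_eq_of_lt]
        · ring
        · rw [hN, mul_comm q Nc]
          exact (Nat.mul_lt_mul_left hnd.pos).2 (ZMod.val_lt _)
      rw [h2, hN, show 2 * (q * Nc) = Nc * (2 * q) by ring,
        Nat.mul_dvd_mul_iff_left hnd.pos] at h1
      exact (Nat.Coprime.mul_left hco2.symm hco.symm).dvd_of_dvd_mul_left h1)
  obtain ⟨r, hr, hS⟩ := even_gauss k ζ (h2q ▸ hζ)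
  rw [← h2q, sum_range_mul_per 2 q (fun y => ζ ^ (y ^ 2))] at hS
  · refine four_case (S := ∑ y ∈ range q, ζ ^ (y ^ 2)) (r := r / 16) (d := (Nat.card D : ℝ))
      (by positivity) (card_pos_real D) ?_ ?_
    · push_cast at hS ⊢
      linear_combination hS / 16
    · rw [hcomb]; push_cast; rfl
  · intro y
    have e : (y + q) ^ 2 = y ^ 2 + (2 * q) * y + q * q := by ring
    simp only [e]
    rw [pow_add, pow_add, hper, pow_mul ζ (2 * q), hζ.pow_eq_one]
    simp

lemma isSquare_of_even_val (N : ℕ) (hN : N ≠ 0)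
    (h : ∀ p, p.Prime → Even (padicValNat p N)) : IsSquare N := by
  obtain ⟨a, b, hab, ha⟩ := Nat.sq_mul_squarefree N
  by_cases h1 : a = 1
  · exact ⟨b, by rw [← hab, h1]; ring⟩
  · exfalso
    obtain ⟨p, hp, hpa⟩ := Nat.exists_prime_and_dvd h1
    have : Fact p.Prime := ⟨hp⟩
    have hb0 : b ≠ 0 := by rintro rfl; simp at hab; exact hN hab.symm
    have ha0 : a ≠ 0 := ha.ne_zero
    have h2 := h p hp
    rw [← hab, padicValNat.mul (pow_ne_zero 2 hb0) ha0, padicValNat.pow] at h2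
    have h3 : padicValNat p a = 1 := by
      rw [← Nat.factorization_def _ hp]
      have := ha.natFactorization_le_one p
      have := hp.factorization_pos_of_dvd ha0 hpa
      omega
    rw [h3] at h2
    obtain ⟨c, hc⟩ := h2
    omega

theorem stmt6 (n m : ℕ) (hn : 0 < n) (hm : 0 < m)
    (C : Submodule (ZMod (n + 1)) (Fin m → ZMod (n + 1))) :
    (Odd n →
      ((C : Set _) = dualCodeA n m (C : Set _) ∧
        ∀ u ∈ C, 2 * (n + 1) ∣ wtE n m u) →
      8 ∣ m * n) ∧
    (Even n → (C : Set _) = dualCodeA n m (C : Set _) → 8 ∣ m * n) := by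
  refine ⟨fun h ⟨hC, hw⟩ => (even_part n m h C hC hw).mul_right n, fun h hC => ?_⟩
  have hcases : n % 8 = 0 ∨ n % 8 = 4 ∨ n % 4 = 2 := by
    obtain ⟨a, ha⟩ := h
    omega
  rcases hcases with h8 | h8 | h8
  · exact (Nat.dvd_of_mod_eq_zero h8).mul_left m
  · have hm2 : Even m := by
      by_contra hmo
      have hs : IsSquare (n + 1) := isSquare_of_even_val _ (by omega) (by
        intro p hp
        by_contra hpo
        rw [Nat.not_even_iff_odd] at hpo
        exact hmo (odd_part n m h C hC p hp hpo).2)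
      obtain ⟨b, hb⟩ := hs
      have h1 : (b * b) % 8 = 5 := by omega
      have h2 : b % 8 < 8 := Nat.mod_lt _ (by norm_num)
      rw [Nat.mul_mod] at h1
      interval_cases b % 8 <;> omega
    have h4 : 4 ∣ n := by omega
    exact mul_dvd_mul (a := 2) (b := m) (c := 4) hm2.two_dvd h4
  · have hm4 : 4 ∣ m := by
      by_contra hmo
      have hs := (Nat.eq_sq_add_sq_iff (n := n + 1)).2 (by
        intro p hp hp3
        by_contra hpo
        rw [Nat.not_even_iff_odd] at hpo
        exact hmo ((odd_part n m h C hC p (Nat.prime_of_mem_primeFactors hp) hpo).1 hp3))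
      obtain ⟨x, y, hxy⟩ := hs
      have h1 : (x ^ 2 + y ^ 2) % 4 = 3 := by omega
      have h2 : x % 4 < 4 := Nat.mod_lt _ (by norm_num)
      have h3 : y % 4 < 4 := Nat.mod_lt _ (by norm_num)
      rw [Nat.add_mod, Nat.pow_mod x, Nat.pow_mod y] at h1
      interval_cases x % 4 <;> interval_cases y % 4 <;> omega
    have h2 : 2 ∣ n := by omega
    exact mul_dvd_mul (a := 4) (b := m) (c := 2) hm4 h2
end

section
/- Let n ≥ 4 be an even integer with n ≢ 0 (mod 4), m a positive integer, and C a code of length m over R = 𝔽₂ + u𝔽₂. Then: (1) Γ_C is integral if and only if C ⊆ C^⊥; (2) Γ_C is unimodular if and only if C = C^⊥; (3) Γ_C is even if and only if 4 divides wt_L(w) for every w ∈ C; (4) Γ_C is even unimodular if and only if C is Type II. -/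
open Finset

/-- The ring `𝔽₂ + u𝔽₂` (dual numbers over `ℤ/2ℤ`, with `u² = 0`). -/
abbrev R2 : Type := DualNumber (ZMod 2)

/-- The bilinear form of `m` copies of the dual `D_n` root lattice (`n` even),
written in the dual basis: `B(x,y) = Σ_i Σ_j Σ_s (1/4)(n − 2|j−s|) x_{ij} y_{is}`. -/
noncomputable def BDev (n m : ℕ) (x y : Fin m → Fin n → ℚ) : ℚ :=
  ∑ i, ∑ j : Fin n, ∑ s : Fin n,
    (1 / 4) * ((n : ℚ) - 2 * |((j : ℕ) : ℚ) - ((s : ℕ) : ℚ)|) * x i j * y i s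

/-- `a_i(x)`: the sum of the odd-numbered (`1`-indexed) coordinates, mod 2. -/
def aD (n m : ℕ) (x : Fin m → Fin n → ℤ) (i : Fin m) : ZMod 2 :=
  ((∑ j ∈ Finset.univ.filter (fun j : Fin n => (j : ℕ) % 2 = 0), x i j : ℤ) : ZMod 2)

/-- `b_i(x)`: the sum of the even-numbered (`1`-indexed) coordinates, mod 2. -/
def bD (n m : ℕ) (x : Fin m → Fin n → ℤ) (i : Fin m) : ZMod 2 :=
  ((∑ j ∈ Finset.univ.filter (fun j : Fin n => (j : ℕ) % 2 = 1), x i j : ℤ) : ZMod 2)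

/-- The reduction map `ρ` to `(𝔽₂ + u𝔽₂)^m`, `ρ(x)_i = a_i + b_i(1+u)`. -/
noncomputable def rhoDev (n m : ℕ) (x : Fin m → Fin n → ℤ) : Fin m → R2 :=
  fun i => algebraMap (ZMod 2) R2 (aD n m x i) +
    algebraMap (ZMod 2) R2 (bD n m x i) * (1 + DualNumber.eps)

open scoped Classical in
/-- `N₀`: the number of coordinates equal to `0`. -/
noncomputable def N0R (m : ℕ) (w : Fin m → R2) : ℕ :=
  (Finset.univ.filter (fun i => w i = 0)).card

open scoped Classical in
/-- `N₂`: the number of coordinates equal to `u`. -/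
noncomputable def N2R (m : ℕ) (w : Fin m → R2) : ℕ :=
  (Finset.univ.filter (fun i => w i = DualNumber.eps)).card

/-- `N₁ = m − N₀ − N₂`. -/
noncomputable def N1R (m : ℕ) (w : Fin m → R2) : ℕ :=
  m - N0R m w - N2R m w

/-- The Lee weight `wt_L = N₁ + 2N₂`. -/
noncomputable def wtLR (m : ℕ) (w : Fin m → R2) : ℕ :=
  N1R m w + 2 * N2R m w

/-- The Hamming weight `wt_H = N₁ + N₂`. -/
noncomputable def wtHR (m : ℕ) (w : Fin m → R2) : ℕ :=
  N1R m w + N2R m w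

/-- The dual code of a set of codewords over `𝔽₂ + u𝔽₂`. -/
def dualCodeR (m : ℕ) (C : Set (Fin m → R2)) : Set (Fin m → R2) :=
  {w | ∀ v ∈ C, ∑ i, w i * v i = 0}

/-- The lattice `Γ_C` constructed from the code `C`. -/
def GammaDev (n m : ℕ) (C : Set (Fin m → R2)) : Set (Fin m → Fin n → ℤ) :=
  {x | rhoDev n m x ∈ C}

/-- Coercion of an integral vector to a rational vector. -/
def toQD (n m : ℕ) (x : Fin m → Fin n → ℤ) : Fin m → Fin n → ℚ :=
  fun i j => (x i j : ℚ)

/-- The dual lattice `Γ_C^*`, taken inside the `ℚ`-valued vectors. -/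
noncomputable def dualLatticeDev (n m : ℕ) (C : Set (Fin m → R2)) :
    Set (Fin m → Fin n → ℚ) :=
  {z | ∀ y ∈ GammaDev n m C, ∃ k : ℤ, (k : ℚ) = BDev n m z (toQD n m y)}

/-- `Γ_C` is integral. -/
def IsIntegralDev (n m : ℕ) (C : Set (Fin m → R2)) : Prop :=
  ∀ x ∈ GammaDev n m C, ∀ y ∈ GammaDev n m C,
    ∃ k : ℤ, (k : ℚ) = BDev n m (toQD n m x) (toQD n m y)

/-- `Γ_C` is even. -/
def IsEvenLatDev (n m : ℕ) (C : Set (Fin m → R2)) : Prop :=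
  IsIntegralDev n m C ∧ ∀ x ∈ GammaDev n m C,
    ∃ k : ℤ, ((2 * k : ℤ) : ℚ) = BDev n m (toQD n m x) (toQD n m x)

/-- `Γ_C` is unimodular. -/
def IsUnimodularDev (n m : ℕ) (C : Set (Fin m → R2)) : Prop :=
  dualLatticeDev n m C = toQD n m '' GammaDev n m C

def SAx (n : ℕ) (x : Fin n → ℤ) : ℤ :=
  ∑ j ∈ Finset.univ.filter (fun j : Fin n => (j : ℕ) % 2 = 0), x j

def SBx (n : ℕ) (x : Fin n → ℤ) : ℤ :=
  ∑ j ∈ Finset.univ.filter (fun j : Fin n => (j : ℕ) % 2 = 1), x j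

def blkx (n : ℕ) (k : ℤ) (x y : Fin n → ℤ) : ℤ :=
  ∑ j : Fin n, ∑ s : Fin n, (k - |((j : ℕ) : ℤ) - ((s : ℕ) : ℤ)|) * x j * y s

def pex (j : ℕ) : ℤ := if j % 2 = 0 then 1 else 0
def qox (j : ℕ) : ℤ := if j % 2 = 1 then 1 else 0

lemma SAx_eq (n : ℕ) (x : Fin n → ℤ) : SAx n x = ∑ j : Fin n, pex j * x j := by
  simp [SAx, pex, Finset.sum_filter]

lemma SBx_eq (n : ℕ) (x : Fin n → ℤ) : SBx n x = ∑ j : Fin n, qox j * x j := by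
  simp [SBx, qox, Finset.sum_filter]

lemma two_BDev (n m k : ℕ) (hk : n = 2 * k) (x y : Fin m → Fin n → ℤ) :
    2 * BDev n m (toQD n m x) (toQD n m y) = ((∑ i, blkx n k (x i) (y i) : ℤ) : ℚ) := by
  unfold BDev blkx toQD
  push_cast
  simp only [Finset.mul_sum]
  refine Finset.sum_congr rfl fun i _ => Finset.sum_congr rfl fun j _ =>
    Finset.sum_congr rfl fun s _ => ?_
  have : (n : ℚ) = 2 * k := by exact_mod_cast hk
  rw [this]
  ring

lemma coef_even (k : ℤ) (hk : k % 2 = 1) (j s : ℕ) :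
    ∃ e : ℤ, (k - |(j : ℤ) - (s : ℤ)|) - k * (pex j * pex s + qox j * qox s) = 2 * e := by
  have hA : |(j : ℤ) - (s : ℤ)| % 2 = ((j : ℤ) + s) % 2 := by
    rcases abs_cases ((j : ℤ) - s) with h | h <;> omega
  have h1 : j % 2 = 0 ∨ j % 2 = 1 := by omega
  have h2 : s % 2 = 0 ∨ s % 2 = 1 := by omega
  apply Int.dvd_def _ _ |>.mp
  rcases h1 with h1 | h1 <;> rcases h2 with h2 | h2 <;> simp [pex, qox, h1, h2] <;> omega

lemma prod_sums (n : ℕ) (k : ℤ) (x y : Fin n → ℤ) :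
    k * (SAx n x * SAx n y + SBx n x * SBx n y) =
      ∑ j : Fin n, ∑ s : Fin n, k * (pex j * pex s + qox j * qox s) * x j * y s := by
  rw [SAx_eq, SAx_eq, SBx_eq, SBx_eq, Finset.sum_mul_sum, Finset.sum_mul_sum,
    ← Finset.sum_add_distrib, Finset.mul_sum]
  refine Finset.sum_congr rfl fun j _ => ?_
  rw [← Finset.sum_add_distrib, Finset.mul_sum]
  refine Finset.sum_congr rfl fun s _ => ?_
  ring

lemma blk_sub (n : ℕ) (k : ℤ) (x y : Fin n → ℤ) :
    blkx n k x y - k * (SAx n x * SAx n y + SBx n x * SBx n y) =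
      ∑ j : Fin n, ∑ s : Fin n, ((k - |((j : ℕ) : ℤ) - ((s : ℕ) : ℤ)|) -
        k * (pex j * pex s + qox j * qox s)) * x j * y s := by
  rw [prod_sums, blkx, ← Finset.sum_sub_distrib]
  refine Finset.sum_congr rfl fun j _ => ?_
  rw [← Finset.sum_sub_distrib]
  refine Finset.sum_congr rfl fun s _ => ?_
  ring

lemma blk_mod2 (n : ℕ) (k : ℤ) (hk : k % 2 = 1) (x y : Fin n → ℤ) :
    ((blkx n k x y : ℤ) : ZMod 2) =
      (SAx n x : ZMod 2) * SAx n y + (SBx n x : ZMod 2) * SBx n y := by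
  have h : (2 : ℤ) ∣ blkx n k x y - k * (SAx n x * SAx n y + SBx n x * SBx n y) := by
    rw [blk_sub]
    refine Finset.dvd_sum fun j _ => Finset.dvd_sum fun s _ => ?_
    obtain ⟨e, he⟩ := coef_even k hk j s
    rw [he]
    exact ⟨e * x j * y s, by ring⟩
  have h2 := (ZMod.intCast_zmod_eq_zero_iff_dvd _ 2).mpr (by exact_mod_cast h)
  have hk2 : (k : ZMod 2) = 1 := by
    have := (ZMod.intCast_eq_intCast_iff k 1 2).mpr (by simpa [Int.ModEq] using hk)
    simpa using this
  push_cast at h2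
  rw [hk2] at h2
  linear_combination h2

lemma blk_mod4 (n : ℕ) (k : ℤ) (hk : k % 2 = 1) (x : Fin n → ℤ) :
    ((blkx n k x x : ℤ) : ZMod 4) =
      (k : ZMod 4) * ((SAx n x : ZMod 4) ^ 2 + (SBx n x : ZMod 4) ^ 2) := by
  have key : ((blkx n k x x - k * (SAx n x * SAx n x + SBx n x * SBx n x) : ℤ) : ZMod 4) = 0 := by
    rw [blk_sub, ← Finset.sum_product', Int.cast_sum]
    refine Finset.sum_involution (fun p _ => (p.2, p.1)) ?_ ?_ ?_ ?_
    · rintro ⟨j, s⟩ -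
      obtain ⟨e, he⟩ := coef_even k hk j s
      obtain ⟨e', he'⟩ := coef_even k hk s j
      have hee : e' = e := by
        rw [abs_sub_comm] at he'
        have : 2 * e' = 2 * e := by rw [← he, ← he']; ring
        omega
      simp only [he, he', hee]
      push_cast
      have h4 : (4 : ZMod 4) = 0 := by decide
      linear_combination (e : ZMod 4) * x j * x s * h4
    · rintro ⟨j, s⟩ - hne heq
      simp only [Prod.mk.injEq] at heq
      obtain ⟨rfl, -⟩ := heq
      apply hne
      have h1 : (s : ℕ) % 2 = 0 ∨ (s : ℕ) % 2 = 1 := by omega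
      rcases h1 with h1 | h1 <;> simp [pex, qox, h1]
    · simp
    · simp
  push_cast at key
  linear_combination key

lemma rho_fst (n m : ℕ) (x : Fin m → Fin n → ℤ) (i : Fin m) :
    (rhoDev n m x i).fst = aD n m x i + bD n m x i := by
  simp [rhoDev, TrivSqZeroExt.algebraMap_eq_inl]

lemma rho_snd (n m : ℕ) (x : Fin m → Fin n → ℤ) (i : Fin m) :
    (rhoDev n m x i).snd = bD n m x i := by
  simp [rhoDev, TrivSqZeroExt.algebraMap_eq_inl]

lemma rho_add (n m : ℕ) (x y : Fin m → Fin n → ℤ) :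
    rhoDev n m (x + y) = rhoDev n m x + rhoDev n m y := by
  funext i
  apply TrivSqZeroExt.ext
  · simp only [Pi.add_apply, TrivSqZeroExt.fst_add, rho_fst, aD, bD, Finset.sum_add_distrib]
    push_cast; ring
  · simp only [Pi.add_apply, TrivSqZeroExt.snd_add, rho_snd, aD, bD, Finset.sum_add_distrib]
    push_cast; ring

lemma rho_surj (n m : ℕ) (hn : 4 ≤ n) (w : Fin m → R2) : ∃ x, rhoDev n m x = w := by
  let f0 : Fin n := ⟨0, by omega⟩
  let f1 : Fin n := ⟨1, by omega⟩
  have h01 : f0 ≠ f1 := by simp [f0, f1]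
  refine ⟨fun i j => if j = f0 then (((w i).fst - (w i).snd : ZMod 2).val : ℤ)
    else if j = f1 then (((w i).snd : ZMod 2).val : ℤ) else 0, ?_⟩
  set x : Fin m → Fin n → ℤ := fun i j => if j = f0 then (((w i).fst - (w i).snd : ZMod 2).val : ℤ)
    else if j = f1 then (((w i).snd : ZMod 2).val : ℤ) else 0 with hx
  have ha : ∀ i, aD n m x i = (w i).fst - (w i).snd := by
    intro i
    unfold aD
    rw [Finset.sum_eq_single_of_mem f0 (by simp [f0])]
    · simp [hx]
    · intro j hj hne
      have : j ≠ f1 := by rintro rfl; simp [f1] at hj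
      simp [hx, hne, this]
  have hb : ∀ i, bD n m x i = (w i).snd := by
    intro i
    unfold bD
    rw [Finset.sum_eq_single_of_mem f1 (by simp [f1])]
    · simp [hx, h01.symm]
    · intro j hj hne
      have : j ≠ f0 := by rintro rfl; simp [f0] at hj
      simp [hx, hne, this]
  funext i
  apply TrivSqZeroExt.ext
  · rw [rho_fst, ha, hb]; ring
  · rw [rho_snd, hb]

lemma two_zmod2 : (2 : ZMod 2) = 0 := by decide

lemma dot_iff (n m : ℕ) (x y : Fin m → Fin n → ℤ) :
    ∑ i, rhoDev n m x i * rhoDev n m y i = 0 ↔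
      (∑ i, (aD n m x i * aD n m y i + bD n m x i * bD n m y i) = 0 ∧
       ∑ i, (aD n m x i * bD n m y i + bD n m x i * aD n m y i) = 0) := by
  have h1 : (∑ i, rhoDev n m x i * rhoDev n m y i).fst =
      ∑ i, (aD n m x i * aD n m y i + bD n m x i * bD n m y i) +
      ∑ i, (aD n m x i * bD n m y i + bD n m x i * aD n m y i) := by
    rw [TrivSqZeroExt.fst_sum, ← Finset.sum_add_distrib]
    refine Finset.sum_congr rfl fun i _ => ?_
    rw [TrivSqZeroExt.fst_mul, rho_fst, rho_fst]; ring
  have h2 : (∑ i, rhoDev n m x i * rhoDev n m y i).snd =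
      ∑ i, (aD n m x i * bD n m y i + bD n m x i * aD n m y i) := by
    rw [TrivSqZeroExt.snd_sum]
    refine Finset.sum_congr rfl fun i _ => ?_
    rw [TrivSqZeroExt.snd_mul, rho_fst, rho_fst, rho_snd, rho_snd]
    simp only [smul_eq_mul, MulOpposite.smul_eq_mul_unop, MulOpposite.unop_op]
    linear_combination bD n m x i * bD n m y i * two_zmod2
  rw [TrivSqZeroExt.ext_iff, h1, h2, TrivSqZeroExt.fst_zero, TrivSqZeroExt.snd_zero]
  constructor
  · rintro ⟨h, h'⟩
    rw [h', add_zero] at h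
    exact ⟨h, h'⟩
  · rintro ⟨h, h'⟩
    rw [h, h', add_zero]
    exact ⟨rfl, rfl⟩

lemma swap_exists (n m : ℕ) (hn : 4 ≤ n) (C : Submodule R2 (Fin m → R2))
    (y : Fin m → Fin n → ℤ) (hy : rhoDev n m y ∈ C) :
    ∃ y', rhoDev n m y' ∈ C ∧ (∀ i, aD n m y' i = bD n m y i) ∧
      (∀ i, bD n m y' i = aD n m y i) := by
  obtain ⟨y', hy'⟩ := rho_surj n m hn (((1 : R2) + DualNumber.eps) • rhoDev n m y)
  have hb : ∀ i, bD n m y' i = aD n m y i := by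
    intro i
    have h := congrArg TrivSqZeroExt.snd (congrFun hy' i)
    rw [rho_snd, Pi.smul_apply, smul_eq_mul, TrivSqZeroExt.snd_mul, rho_fst, rho_snd] at h
    rw [h]
    simp
    linear_combination bD n m y i * two_zmod2
  refine ⟨y', hy' ▸ C.smul_mem _ hy, ?_, hb⟩
  intro i
  have h := congrArg TrivSqZeroExt.fst (congrFun hy' i)
  rw [rho_fst, Pi.smul_apply, smul_eq_mul, TrivSqZeroExt.fst_mul, rho_fst, hb] at h
  simp at h
  linear_combination h

lemma int_iff (n m k : ℕ) (hk : n = 2 * k) (hk2 : k % 2 = 1) (x y : Fin m → Fin n → ℤ) :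
    (∃ t : ℤ, (t : ℚ) = BDev n m (toQD n m x) (toQD n m y)) ↔
      ∑ i, (aD n m x i * aD n m y i + bD n m x i * bD n m y i) = 0 := by
  have h := two_BDev n m k hk x y
  have h2 : ((∑ i, blkx n k (x i) (y i) : ℤ) : ZMod 2) =
      ∑ i, (aD n m x i * aD n m y i + bD n m x i * bD n m y i) := by
    rw [Int.cast_sum]
    exact Finset.sum_congr rfl fun i _ => blk_mod2 n k (by omega) (x i) (y i)
  rw [← h2, ZMod.intCast_zmod_eq_zero_iff_dvd]
  constructor
  · rintro ⟨t, ht⟩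
    refine ⟨t, ?_⟩
    rw [← ht] at h
    exact_mod_cast h.symm
  · rintro ⟨t, ht⟩
    refine ⟨t, ?_⟩
    rw [ht] at h
    push_cast at h
    linarith

lemma orth_iff (n m k : ℕ) (hn : 4 ≤ n) (hk : n = 2 * k) (hk2 : k % 2 = 1)
    (C : Submodule R2 (Fin m → R2)) (x : Fin m → Fin n → ℤ) :
    (∀ y ∈ GammaDev n m (C : Set _), ∃ t : ℤ, (t : ℚ) = BDev n m (toQD n m x) (toQD n m y)) ↔
      rhoDev n m x ∈ dualCodeR m (C : Set _) := by
  constructor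
  · intro h v hv
    obtain ⟨y, rfl⟩ := rho_surj n m hn v
    obtain ⟨y', hy', ha, hb⟩ := swap_exists n m hn C y hv
    rw [dot_iff]
    refine ⟨(int_iff n m k hk hk2 x y).mp (h y hv), ?_⟩
    have := (int_iff n m k hk hk2 x y').mp (h y' hy')
    simpa only [ha, hb] using this
  · intro h y hy
    exact (int_iff n m k hk hk2 x y).mpr ((dot_iff n m x y).mp (h _ hy)).1

lemma even_iff (n m k : ℕ) (hk : n = 2 * k) (hk2 : k % 2 = 1) (x : Fin m → Fin n → ℤ) :
    (∃ t : ℤ, ((2 * t : ℤ) : ℚ) = BDev n m (toQD n m x) (toQD n m x)) ↔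
      ∑ i, ((SAx n (x i) : ZMod 4) ^ 2 + (SBx n (x i) : ZMod 4) ^ 2) = 0 := by
  have h := two_BDev n m k hk x x
  have h2 : ((∑ i, blkx n k (x i) (x i) : ℤ) : ZMod 4) =
      (k : ZMod 4) * ∑ i, ((SAx n (x i) : ZMod 4) ^ 2 + (SBx n (x i) : ZMod 4) ^ 2) := by
    rw [Int.cast_sum, Finset.mul_sum]
    refine Finset.sum_congr rfl fun i _ => ?_
    have := blk_mod4 n k (by omega) (x i)
    simpa using this
  have hkk : (k : ZMod 4) * k = 1 := by
    have h8 : k % 4 = 1 ∨ k % 4 = 3 := by omega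
    have : ((k : ℕ) : ZMod 4) = ((k % 4 : ℕ) : ZMod 4) := by simp
    rw [this]
    rcases h8 with h8 | h8 <;> rw [h8] <;> decide
  have h3 : ∑ i, ((SAx n (x i) : ZMod 4) ^ 2 + (SBx n (x i) : ZMod 4) ^ 2) = 0 ↔
      ((∑ i, blkx n k (x i) (x i) : ℤ) : ZMod 4) = 0 := by
    rw [h2]
    constructor
    · intro h; rw [h, mul_zero]
    · intro h
      have := congrArg (fun z => (k : ZMod 4) * z) h
      simpa [← mul_assoc, hkk] using this
  rw [h3, ZMod.intCast_zmod_eq_zero_iff_dvd]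
  constructor
  · rintro ⟨t, ht⟩
    refine ⟨t, ?_⟩
    rw [← ht] at h
    have h' : 2 * (2 * t) = ∑ i, blkx n k (x i) (x i) := by exact_mod_cast h
    push_cast
    linarith
  · rintro ⟨t, ht⟩
    refine ⟨t, ?_⟩
    rw [ht] at h
    push_cast at h ⊢
    linarith

open scoped Classical in
lemma wt_cast (m : ℕ) (w : Fin m → R2) : ((wtLR m w : ℕ) : ZMod 4) =
    ∑ i, (1 - (if w i = 0 then 1 else 0) + (if w i = DualNumber.eps then 1 else 0) : ZMod 4) := by
  have hdis : N0R m w + N2R m w ≤ m := by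
    unfold N0R N2R
    rw [← Finset.card_union_of_disjoint]
    · exact (Finset.card_le_univ _).trans (by simp)
    · rw [Finset.disjoint_filter]
      intro i _ h0 h1
      rw [h0] at h1
      have := congrArg TrivSqZeroExt.snd h1
      simp at this
  have e : wtLR m w + N0R m w = m + N2R m w := by
    unfold wtLR N1R; omega
  have e' : ((wtLR m w : ℕ) : ZMod 4) = m - (N0R m w : ℕ) + (N2R m w : ℕ) := by
    have := congrArg (Nat.cast : ℕ → ZMod 4) e
    push_cast at this
    linear_combination this
  rw [e', Finset.sum_add_distrib, Finset.sum_sub_distrib, Finset.sum_boole, Finset.sum_boole]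
  simp [N0R, N2R]

open scoped Classical in
lemma wt_rho (n m : ℕ) (x : Fin m → Fin n → ℤ) :
    ((wtLR m (rhoDev n m x) : ℕ) : ZMod 4) =
      ∑ i, ((SAx n (x i) : ZMod 4) ^ 2 + (SBx n (x i) : ZMod 4) ^ 2) := by
  rw [wt_cast]
  refine Finset.sum_congr rfl fun i _ => ?_
  have h0 : rhoDev n m x i = 0 ↔ (aD n m x i = 0 ∧ bD n m x i = 0) := by
    rw [TrivSqZeroExt.ext_iff, rho_fst, rho_snd, TrivSqZeroExt.fst_zero, TrivSqZeroExt.snd_zero]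
    generalize aD n m x i = a
    generalize bD n m x i = b
    revert a b; decide
  have h1 : rhoDev n m x i = DualNumber.eps ↔ (aD n m x i = 1 ∧ bD n m x i = 1) := by
    rw [TrivSqZeroExt.ext_iff, rho_fst, rho_snd, DualNumber.fst_eps, DualNumber.snd_eps]
    generalize aD n m x i = a
    generalize bD n m x i = b
    revert a b; decide
  have ha : aD n m x i = ZMod.castHom (show 2 ∣ 4 by norm_num) (ZMod 2) (SAx n (x i) : ZMod 4) := by
    rw [map_intCast]; rfl
  have hb : bD n m x i = ZMod.castHom (show 2 ∣ 4 by norm_num) (ZMod 2) (SBx n (x i) : ZMod 4) := by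
    rw [map_intCast]; rfl
  simp only [h0, h1, ha, hb]
  generalize (SAx n (x i) : ZMod 4) = a
  generalize (SBx n (x i) : ZMod 4) = b
  have key : ∀ a b : ZMod 4, ((1 - (if (ZMod.castHom (show 2 ∣ 4 by norm_num) (ZMod 2) a = 0 ∧
      ZMod.castHom (show 2 ∣ 4 by norm_num) (ZMod 2) b = 0) then 1 else 0) +
      (if (ZMod.castHom (show 2 ∣ 4 by norm_num) (ZMod 2) a = 1 ∧
      ZMod.castHom (show 2 ∣ 4 by norm_num) (ZMod 2) b = 1) then 1 else 0) : ZMod 4)) =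
      a ^ 2 + b ^ 2 := by decide
  convert key a b

lemma even_wt (n m k : ℕ) (hk : n = 2 * k) (hk2 : k % 2 = 1) (x : Fin m → Fin n → ℤ) :
    (∃ t : ℤ, ((2 * t : ℤ) : ℚ) = BDev n m (toQD n m x) (toQD n m x)) ↔
      4 ∣ wtLR m (rhoDev n m x) := by
  rw [even_iff n m k hk hk2, ← wt_rho, ZMod.natCast_eq_zero_iff]

lemma BDev_symm (n m : ℕ) (x y : Fin m → Fin n → ℚ) : BDev n m x y = BDev n m y x := by
  unfold BDev
  refine Finset.sum_congr rfl fun i _ => ?_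
  rw [Finset.sum_comm]
  refine Finset.sum_congr rfl fun j _ => Finset.sum_congr rfl fun s _ => ?_
  rw [abs_sub_comm]; ring

lemma BDev_add_left (n m : ℕ) (x x' y : Fin m → Fin n → ℚ) :
    BDev n m (x + x') y = BDev n m x y + BDev n m x' y := by
  unfold BDev
  simp only [← Finset.sum_add_distrib]
  refine Finset.sum_congr rfl fun i _ => Finset.sum_congr rfl fun j _ =>
    Finset.sum_congr rfl fun s _ => ?_
  simp only [Pi.add_apply]; ring

lemma toQD_add (n m : ℕ) (x y : Fin m → Fin n → ℤ) :
    toQD n m (x + y) = toQD n m x + toQD n m y := by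
  funext i j; simp [toQD]

lemma toQD_inj (n m : ℕ) : Function.Injective (toQD n m) := by
  intro x y h
  funext i j
  have := congrFun (congrFun h i) j
  simpa [toQD] using this

/-- A vector supported on row `i`, with value `2 e_p + c e_q + d e_r`. -/
def testx (n m : ℕ) (i : Fin m) (p q r : Fin n) (c d : ℤ) : Fin m → Fin n → ℤ :=
  fun i' j => if i' = i then (2 * (if j = p then 1 else 0) + c * (if j = q then 1 else 0)
    + d * (if j = r then 1 else 0)) else 0

lemma BDev_testx (n m : ℕ) (i : Fin m) (p q r : Fin n) (c d : ℤ) (z : Fin m → Fin n → ℚ)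
    (h : ∀ j : Fin n, 2 * ((n : ℚ) - 2 * |((j : ℕ) : ℚ) - ((p : ℕ) : ℚ)|)
      + c * ((n : ℚ) - 2 * |((j : ℕ) : ℚ) - ((q : ℕ) : ℚ)|)
      + d * ((n : ℚ) - 2 * |((j : ℕ) : ℚ) - ((r : ℕ) : ℚ)|) = if j = p then 4 else 0) :
    BDev n m z (toQD n m (testx n m i p q r c d)) = z i p := by
  unfold BDev
  rw [Finset.sum_eq_single i]
  · have : ∀ j : Fin n, ∑ s : Fin n, (1 / 4) * ((n : ℚ) - 2 * |((j : ℕ) : ℚ) - ((s : ℕ) : ℚ)|)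
        * z i j * toQD n m (testx n m i p q r c d) i s = if j = p then z i j else 0 := by
      intro j
      have e : ∑ s : Fin n, (1 / 4) * ((n : ℚ) - 2 * |((j : ℕ) : ℚ) - ((s : ℕ) : ℚ)|)
        * z i j * toQD n m (testx n m i p q r c d) i s = (1 / 4) * z i j *
          (2 * ((n : ℚ) - 2 * |((j : ℕ) : ℚ) - ((p : ℕ) : ℚ)|)
      + c * ((n : ℚ) - 2 * |((j : ℕ) : ℚ) - ((q : ℕ) : ℚ)|)
      + d * ((n : ℚ) - 2 * |((j : ℕ) : ℚ) - ((r : ℕ) : ℚ)|)) := by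
        simp only [toQD, testx, if_true]
        push_cast
        simp only [mul_add, Finset.sum_add_distrib, mul_ite, mul_one, mul_zero,
          Finset.sum_ite_eq', Finset.mem_univ, if_true, Int.cast_ite, Int.cast_zero]
        simp
        ring
      rw [e, h]
      split_ifs <;> ring
    simp only [this]
    simp
  · intro i' _ hne
    simp [toQD, testx, hne]
  · simp

lemma testx_rho (n m : ℕ) (i : Fin m) (p q r : Fin n) (c d : ℤ) (hc : c % 2 = 1) (hd : d % 2 = 1)
    (hqr : (q : ℕ) % 2 = (r : ℕ) % 2) : rhoDev n m (testx n m i p q r c d) = 0 := by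
  have hc' : (c : ZMod 2) = 1 := by
    have := (ZMod.intCast_eq_intCast_iff c 1 2).mpr (by simpa [Int.ModEq] using hc)
    simpa using this
  have hd' : (d : ZMod 2) = 1 := by
    have := (ZMod.intCast_eq_intCast_iff d 1 2).mpr (by simpa [Int.ModEq] using hd)
    simpa using this
  have h11 : (1 : ZMod 2) + 1 = 0 := by decide
  have gen : ∀ (e : ℕ) (i' : Fin m), ((∑ j ∈ Finset.univ.filter (fun j : Fin n => (j : ℕ) % 2 = e),
      testx n m i p q r c d i' j : ℤ) : ZMod 2) = 0 := by
    intro e i'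
    by_cases hi : i' = i
    · rw [Finset.sum_filter]
      simp only [testx, hi, if_true]
      push_cast
      simp only [two_zmod2, hc', hd', zero_mul, zero_add, one_mul]
      have : ∀ j : Fin n, (if (j : ℕ) % 2 = e then ((if j = q then (1 : ZMod 2) else 0) +
          (if j = r then 1 else 0)) else 0) = (if j = q then (if (q : ℕ) % 2 = e then 1 else 0) else 0)
          + (if j = r then (if (q : ℕ) % 2 = e then 1 else 0) else 0) := by
        intro j
        by_cases h1 : j = q <;> by_cases h2 : j = r <;> by_cases h3 : (j : ℕ) % 2 = e <;>
          simp_all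
      push_cast
      simp [this, Finset.sum_add_distrib]
      split_ifs <;> simp [h11]
    · simp [testx, hi]
  funext i'
  apply TrivSqZeroExt.ext
  · rw [rho_fst, aD, bD, gen, gen]; simp
  · rw [rho_snd, bD, gen]; simp

lemma dual_integral (n m k : ℕ) (hn : 4 ≤ n) (hk : n = 2 * k) (C : Submodule R2 (Fin m → R2))
    (z : Fin m → Fin n → ℚ) (hz : z ∈ dualLatticeDev n m (C : Set _)) :
    ∃ x, toQD n m x = z := by
  have key : ∀ i p, ∃ t : ℤ, (t : ℚ) = z i p := by
    intro i p
    have step : ∀ (q r : Fin n) (c d : ℤ), c % 2 = 1 → d % 2 = 1 →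
        (q : ℕ) % 2 = (r : ℕ) % 2 →
        (∀ j : Fin n, 2 * ((n : ℤ) - 2 * |((j : ℕ) : ℤ) - ((p : ℕ) : ℤ)|)
      + c * ((n : ℤ) - 2 * |((j : ℕ) : ℤ) - ((q : ℕ) : ℤ)|)
      + d * ((n : ℤ) - 2 * |((j : ℕ) : ℤ) - ((r : ℕ) : ℤ)|) = if j = p then 4 else 0) →
        ∃ t : ℤ, (t : ℚ) = z i p := by
      intro q r c d hc hd hqr h
      have := hz (testx n m i p q r c d) (by
        change rhoDev n m _ ∈ C
        rw [testx_rho n m i p q r c d hc hd hqr]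
        exact C.zero_mem)
      rwa [BDev_testx] at this
      intro j
      have h' := congrArg (Int.cast : ℤ → ℚ) (h j)
      push_cast at h'
      rw [h']
    have hp := p.isLt
    by_cases h0 : (p : ℕ) = 0
    · refine step ⟨1, by omega⟩ ⟨n - 1, by omega⟩ (-1) 1 (by norm_num) (by norm_num)
        (by simp only; omega) ?_
      intro j
      have hj := j.isLt
      simp only [Fin.ext_iff]
      split_ifs <;> grind
    · by_cases h1 : (p : ℕ) = n - 1
      · refine step ⟨n - 2, by omega⟩ ⟨0, by omega⟩ (-1) 1 (by norm_num) (by norm_num)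
          (by simp only; omega) ?_
        intro j
        have hj := j.isLt
        simp only [Fin.ext_iff]
        split_ifs <;> grind
      · refine step ⟨p - 1, by omega⟩ ⟨p + 1, by omega⟩ (-1) (-1) (by norm_num) (by norm_num)
          (by simp only; omega) ?_
        intro j
        have hj := j.isLt
        simp only [Fin.ext_iff]
        split_ifs <;> grind
  choose f hf using key
  exact ⟨f, by funext i j; exact hf i j⟩

lemma dual_eq (n m k : ℕ) (hn : 4 ≤ n) (hk : n = 2 * k) (hk2 : k % 2 = 1)
    (C : Submodule R2 (Fin m → R2)) :
    dualLatticeDev n m (C : Set _) = toQD n m '' GammaDev n m (dualCodeR m (C : Set _)) := by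
  ext z
  constructor
  · intro hz
    obtain ⟨x, rfl⟩ := dual_integral n m k hn hk C z hz
    exact ⟨x, (orth_iff n m k hn hk hk2 C x).mp hz, rfl⟩
  · rintro ⟨x, hx, rfl⟩
    exact (orth_iff n m k hn hk hk2 C x).mpr hx

theorem stmt11 (n m : ℕ) (hn : 4 ≤ n) (heven : Even n) (hn4 : ¬ (4 ∣ n))
    (hm : 0 < m) (C : Submodule R2 (Fin m → R2)) :
    (IsIntegralDev n m (C : Set _) ↔ (C : Set _) ⊆ dualCodeR m (C : Set _)) ∧
    (IsUnimodularDev n m (C : Set _) ↔ (C : Set _) = dualCodeR m (C : Set _)) ∧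
    (IsEvenLatDev n m (C : Set _) ↔ ∀ w ∈ C, 4 ∣ wtLR m w) ∧
    ((IsEvenLatDev n m (C : Set _) ∧ IsUnimodularDev n m (C : Set _)) ↔
      ((C : Set _) = dualCodeR m (C : Set _) ∧ ∀ w ∈ C, 4 ∣ wtLR m w)) := by
  obtain ⟨k, hk⟩ := heven
  have hk : n = 2 * k := by omega
  have hk2 : k % 2 = 1 := by omega
  have p1 : IsIntegralDev n m (C : Set _) ↔ (C : Set _) ⊆ dualCodeR m (C : Set _) := by
    constructor
    · intro h w hw
      obtain ⟨x, rfl⟩ := rho_surj n m hn w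
      exact (orth_iff n m k hn hk hk2 C x).mp (h x hw)
    · intro h x hx
      exact (orth_iff n m k hn hk hk2 C x).mpr (h hx)
  have p2 : IsUnimodularDev n m (C : Set _) ↔ (C : Set _) = dualCodeR m (C : Set _) := by
    unfold IsUnimodularDev
    rw [dual_eq n m k hn hk hk2, (toQD_inj n m).image_injective.eq_iff]
    have hs : Function.Surjective (rhoDev n m) := rho_surj n m hn
    change rhoDev n m ⁻¹' _ = rhoDev n m ⁻¹' _ ↔ _
    rw [hs.preimage_injective.eq_iff, eq_comm]
  have p3 : IsEvenLatDev n m (C : Set _) ↔ ∀ w ∈ C, 4 ∣ wtLR m w := by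
    constructor
    · rintro ⟨-, h⟩ w hw
      obtain ⟨x, rfl⟩ := rho_surj n m hn w
      exact (even_wt n m k hk hk2 x).mp (h x hw)
    · intro h
      have hev : ∀ x ∈ GammaDev n m (C : Set _),
          ∃ k : ℤ, ((2 * k : ℤ) : ℚ) = BDev n m (toQD n m x) (toQD n m x) :=
        fun x hx => (even_wt n m k hk hk2 x).mpr (h _ hx)
      refine ⟨fun x hx y hy => ?_, hev⟩
      obtain ⟨a, ha⟩ := hev x hx
      obtain ⟨b, hb⟩ := hev y hy
      obtain ⟨c, hc⟩ := hev (x + y) (by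
        change rhoDev n m _ ∈ C
        rw [rho_add]
        exact C.add_mem hx hy)
      refine ⟨c - a - b, ?_⟩
      rw [toQD_add, BDev_add_left, BDev_symm n m (toQD n m x) (_ + _),
        BDev_symm n m (toQD n m y) (_ + _), BDev_add_left, BDev_add_left,
        BDev_symm n m (toQD n m y) (toQD n m x)] at hc
      push_cast at *
      linarith
  refine ⟨p1, p2, p3, ?_⟩
  rw [p2, p3, and_comm]
end
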